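/- Let d ≥ 1, M ≥ 1, L = (M+1)d, and let C be a symmetric L×L real matrix. Let 𝕊₊ be the set of L×L symmetric positive semidefinite matrices, and Ω the set of L×L symmetric matrices all of whose M+1 diagonal d×d blocks equal I_d. Let F* be the minimum of Trace(C G) over G ∈ 𝕊₊ with [G]_ii = I_d for all 1 ≤ i ≤ M+1 (this minimum is attained since the feasible set is nonempty and compact). Fix ρ > 0, and starting from symmetric matrices H⁰ and Λ⁰, define the ADMM iterates for k ≥ 0 by G^{k+1} = Π_{𝕊₊}(H^k − ρ⁻¹(C − Λ^k)), H^{k+1} = Π_Ω(G^{k+1} − ρ⁻¹Λ^k), Λ^{k+1} = Λ^k + ρ(H^{k+1} − G^{k+1}), where Π_𝒮(A) denotes the unique nearest point of the nonempty closed convex set 𝒮 to A in the Frobenius norm. Then: (objective convergence) Trace(C G^k) → F* as k → ∞; and (asymptotic feasibility) [G^k]_ii → I_d as k → ∞ for each 1 ≤ i ≤ M+1, i.e., the sequence (G^k) approaches the feasible set of the semidefinite program. -/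

import Mathlib

open Matrix Filter

/-- The Frobenius norm of a square real matrix. -/
noncomputable def frobNorm {L : Type*} [Fintype L] (A : Matrix L L ℝ) : ℝ :=
  Real.sqrt (∑ p, ∑ q, A p q ^ 2)

/-- The variational inequality satisfied by a nearest point of a convex set. -/
theorem inner_sub_nonneg_of_forall_norm_sub_le {E : Type*} [NormedAddCommGroup E]
    [InnerProductSpace ℝ E] {K : Set E} (hK : Convex ℝ K) {a g : E} (hg : g ∈ K)
    (hmin : ∀ x ∈ K, ‖g - a‖ ≤ ‖x - a‖) {x : E} (hx : x ∈ K) :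
    0 ≤ inner ℝ (g - a) (x - g) := by
  have h := (norm_eq_iInf_iff_real_inner_le_zero (u := a) hK hg).1 (by
    have : Nonempty K := ⟨⟨g, hg⟩⟩
    apply le_antisymm
    · refine le_ciInf fun w => ?_
      rw [norm_sub_rev a g, norm_sub_rev a]
      exact hmin w w.2
    · exact ciInf_le (f := fun w : K => ‖a - w‖)
        ⟨0, by rintro _ ⟨w, rfl⟩; exact norm_nonneg _⟩ ⟨g, hg⟩) x hx
  rw [← neg_sub a g, inner_neg_left]
  linarith

/-- Lagrangian strong duality with dual attainment under Slater's condition, for the minimization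
of a linear functional over the intersection of two convex sets. -/
theorem exists_multiplier_of_mem_interior {E : Type*} [NormedAddCommGroup E] [NormedSpace ℝ E]
    {K Ω : Set E} (hK : Convex ℝ K) (hΩ : Convex ℝ Ω) {z : E} (hzK : z ∈ interior K)
    (hzΩ : z ∈ Ω) (c : E →L[ℝ] ℝ) {F : ℝ} (hF : ∀ x ∈ K, x ∈ Ω → F ≤ c x) :
    ∃ f : E →L[ℝ] ℝ, ∀ g ∈ K, ∀ h ∈ Ω, F ≤ c g + f (h - g) := by
  let S : Set (E × ℝ) := {p | ∃ h ∈ Ω, h - p.1 ∈ interior K ∧ c (h - p.1) < p.2}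
  have hSopen : IsOpen S := by
    have : S = ⋃ h ∈ Ω, {p : E × ℝ | h - p.1 ∈ interior K ∧ c (h - p.1) < p.2} := by
      ext p
      simp only [S, Set.mem_iUnion, Set.mem_ofPred_eq, exists_prop]
    rw [this]
    refine isOpen_biUnion fun h _ => ?_
    have hcont : Continuous fun p : E × ℝ => h - p.1 := by fun_prop
    exact (isOpen_interior.preimage hcont).inter (isOpen_lt (c.continuous.comp hcont)
      continuous_snd)
  have hSconv : Convex ℝ S := by
    rintro ⟨u, t⟩ ⟨h, hh, hu, ht⟩ ⟨u', t'⟩ ⟨h', hh', hu', ht'⟩ a b ha hb hab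
    have key : a • h + b • h' - (a • u + b • u') = a • (h - u) + b • (h' - u') := by module
    refine ⟨a • h + b • h', hΩ hh hh' ha hb hab, ?_, ?_⟩
    · simpa only [Prod.smul_mk, Prod.mk_add_mk, key] using hK.interior hu hu' ha hb hab
    · simp only [Prod.smul_mk, Prod.mk_add_mk, key, map_add, map_smul, smul_eq_mul] at ht ht' ⊢
      rcases ha.eq_or_lt with rfl | ha
      · obtain rfl : b = 1 := by linarith
        simpa using ht'
      · have := mul_lt_mul_of_pos_left ht ha
        have := mul_le_mul_of_nonneg_left ht'.le hb
        linarith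
  have hnot : ((0 : E), F) ∉ S := by
    rintro ⟨h, hh, hu, ht⟩
    simp only [sub_zero] at hu ht
    exact absurd (hF h (interior_subset hu) hh) (not_le.2 ht)
  obtain ⟨φ, hφ⟩ := geometric_hahn_banach_open_point hSconv hSopen hnot
  have hsplit : ∀ (u : E) (t : ℝ), φ (u, t) = φ (u, 0) + t * φ (0, 1) := by
    intro u t
    have : ((u, t) : E × ℝ) = (u, 0) + t • ((0 : E), (1 : ℝ)) := by simp
    rw [this, map_add, map_smul, smul_eq_mul]
  set s := φ (0, 1) with hs
  have hφ0 : φ ((0 : E), (0 : ℝ)) = 0 := φ.map_zero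
  have hφ' : ∀ h ∈ Ω, ∀ g ∈ interior K, ∀ t, c g < t → φ (h - g, 0) + t * s < F * s := by
    intro h hh g hg t ht
    have := hφ (h - g, t) ⟨h, hh, by simpa using hg, by simpa using ht⟩
    rw [hsplit, hsplit 0 F, hφ0, zero_add] at this
    exact this
  have hsneg : s < 0 := by
    have h1 := hφ' z hzΩ z hzK (max (c z) F + 1) (by linarith [le_max_left (c z) F])
    rw [sub_self, hφ0] at h1
    by_contra! hcon
    nlinarith [le_max_right (c z) F]
  refine ⟨(-s)⁻¹ • -(φ.comp (ContinuousLinearMap.inl ℝ E ℝ)), fun g hg h hh => ?_⟩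
  have hgcl : g ∈ closure (interior K) := by
    rw [hK.closure_interior_eq_closure_of_nonempty_interior ⟨z, hzK⟩]
    exact subset_closure hg
  refine closure_minimal (t := {g | F ≤ c g +
    ((-s)⁻¹ • -(φ.comp (ContinuousLinearMap.inl ℝ E ℝ))) (h - g)}) ?_ ?_ hgcl
  · intro g hg
    have hle : φ (h - g, 0) ≤ (F - c g) * s := by
      refine le_of_forall_pos_lt_add fun ε hε => ?_
      have := hφ' h hh g hg (c g + ε / (-s)) (by
        have := div_pos hε (neg_pos.2 hsneg); linarith)
      have h2 : ε / (-s) * s = -ε := by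
        rw [div_neg, neg_mul, div_mul_cancel₀ _ hsneg.ne]
      nlinarith
    have : F - c g ≤ (-s)⁻¹ * -φ (h - g, 0) := by
      rw [inv_mul_eq_div, le_div_iff₀ (neg_pos.2 hsneg)]
      linarith
    simp only [Set.mem_ofPred_eq, _root_.smul_apply, _root_.neg_apply,
      ContinuousLinearMap.comp_apply, ContinuousLinearMap.inl_apply, smul_eq_mul]
    linarith
  · exact isClosed_le (by fun_prop) (by fun_prop)

/-- The one-step decrease of the ADMM energy, in terms of the multiplier error `a`, the primal
error `b`, the residual `r` and the step `d`. -/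
theorem admm_energy_le {E : Type*} [NormedAddCommGroup E] [InnerProductSpace ℝ E] {ρ : ℝ}
    (hρ : 0 ≤ ρ) {a b r d : E} (h : inner ℝ a r + ρ * inner ℝ b d ≤ 0) :
    ρ ^ 2 * ‖r‖ ^ 2 + ρ ^ 2 * ‖d‖ ^ 2 ≤
      ‖a - ρ • r‖ ^ 2 + ρ ^ 2 * ‖b - d‖ ^ 2 - (‖a‖ ^ 2 + ρ ^ 2 * ‖b‖ ^ 2) := by
  rw [norm_sub_sq_real, norm_sub_sq_real, norm_smul, mul_pow, real_inner_smul_right,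
    Real.norm_eq_abs, sq_abs]
  nlinarith [mul_nonpos_of_nonneg_of_nonpos hρ h]

/-- Convergence of the two-block ADMM for minimizing `⟪c, ·⟫` over `K ∩ Ω`, given a saddle point
`(z, μ)` of the Lagrangian. -/
theorem tendsto_inner_and_residual_of_admm {E : Type*} [NormedAddCommGroup E]
    [InnerProductSpace ℝ E] {K Ω : Set E} (hK : Convex ℝ K) (hΩ : Convex ℝ Ω) {c z μ : E}
    (hzK : z ∈ K) (hzΩ : z ∈ Ω)
    (hμ : ∀ g ∈ K, ∀ h ∈ Ω, inner ℝ c z ≤ inner ℝ c g + inner ℝ μ (h - g))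
    {ρ : ℝ} (hρ : 0 < ρ) {g h l : ℕ → E}
    (hgK : ∀ k, g (k + 1) ∈ K)
    (hgmin : ∀ k, ∀ x ∈ K, ‖g (k + 1) - (h k - ρ⁻¹ • (c - l k))‖ ≤
      ‖x - (h k - ρ⁻¹ • (c - l k))‖)
    (hhΩ : ∀ k, h (k + 1) ∈ Ω)
    (hhmin : ∀ k, ∀ x ∈ Ω, ‖h (k + 1) - (g (k + 1) - ρ⁻¹ • l k)‖ ≤
      ‖x - (g (k + 1) - ρ⁻¹ • l k)‖)
    (hl : ∀ k, l (k + 1) = l k + ρ • (h (k + 1) - g (k + 1))) :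
    Tendsto (fun k => inner ℝ c (g k)) atTop (nhds (inner ℝ c z)) ∧
      Tendsto (fun k => h k - g k) atTop (nhds 0) := by
  have hg_vi : ∀ k, ∀ x ∈ K,
      0 ≤ inner ℝ (c - l (k + 1) + ρ • (h (k + 1) - h k)) (x - g (k + 1)) := by
    intro k x hx
    have h1 := inner_sub_nonneg_of_forall_norm_sub_le hK (hgK k) (hgmin k) hx
    have h2 : c - l (k + 1) + ρ • (h (k + 1) - h k) =
        ρ • (g (k + 1) - (h k - ρ⁻¹ • (c - l k))) := by
      rw [hl, smul_sub ρ (g (k + 1)), smul_sub ρ (h k), smul_inv_smul₀ hρ.ne']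
      module
    rw [h2, real_inner_smul_left]
    positivity
  have hh_vi : ∀ k, ∀ x ∈ Ω, 0 ≤ inner ℝ (l (k + 1)) (x - h (k + 1)) := by
    intro k x hx
    have h1 := inner_sub_nonneg_of_forall_norm_sub_le hΩ (hhΩ k) (hhmin k) hx
    have h2 : l (k + 1) = ρ • (h (k + 1) - (g (k + 1) - ρ⁻¹ • l k)) := by
      rw [hl, smul_sub ρ (h (k + 1)) (_ - _), smul_sub ρ (g (k + 1)) (_ • _),
        smul_inv_smul₀ hρ.ne']
      module
    rw [h2, real_inner_smul_left]
    positivity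
  have hupper : ∀ k, inner ℝ c (g (k + 1)) ≤ inner ℝ c z
      - inner ℝ (l (k + 1)) (h (k + 1) - g (k + 1))
      + ρ * inner ℝ (h (k + 1) - h k) (z - g (k + 1)) := by
    intro k
    have h1 := hg_vi k z hzK
    have h2 := hh_vi k z hzΩ
    simp only [inner_add_left, inner_sub_left, inner_sub_right, real_inner_smul_left] at h1 h2 ⊢
    linarith
  have hlower : ∀ k, inner ℝ c z - inner ℝ μ (h (k + 1) - g (k + 1)) ≤ inner ℝ c (g (k + 1)) :=
    fun k => by linarith [hμ _ (hgK k) _ (hhΩ k)]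
  let V : ℕ → ℝ := fun k => ‖l (k + 1) - μ‖ ^ 2 + ρ ^ 2 * ‖h (k + 1) - z‖ ^ 2
  have hV : ∀ k, V k = ‖l (k + 1) - μ‖ ^ 2 + ρ ^ 2 * ‖h (k + 1) - z‖ ^ 2 := fun _ => rfl
  have hdesc : ∀ k, ρ ^ 2 * ‖h (k + 2) - g (k + 2)‖ ^ 2 + ρ ^ 2 * ‖h (k + 2) - h (k + 1)‖ ^ 2 ≤
      V k - V (k + 1) := by
    intro k
    have h1 := hupper (k + 1)
    have h2 := hlower (k + 1)
    have h3 := hh_vi k _ (hhΩ (k + 1))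
    have h4 := hh_vi (k + 1) _ (hhΩ k)
    have hl' := hl (k + 1)
    simp only [add_assoc, Nat.reduceAdd] at h1 h2 h3 h4 hl'
    have hlk : l (k + 1) = l (k + 2) - ρ • (h (k + 2) - g (k + 2)) := by rw [hl']; abel
    rw [hV, hV]
    simp only [add_assoc, Nat.reduceAdd]
    have hdr : inner ℝ (h (k + 2) - h (k + 1)) (h (k + 2) - g (k + 2)) ≤ 0 := by
      rw [← neg_sub (h (k + 2)), inner_neg_right] at h4
      rw [hlk, inner_sub_left, real_inner_smul_left] at h3
      rw [real_inner_comm]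
      exact nonpos_of_mul_nonpos_right (by linarith) hρ
    have hzg : z - g (k + 2) = (h (k + 2) - g (k + 2)) - (h (k + 2) - z) := by abel
    rw [hzg, inner_sub_right (h (k + 2) - h (k + 1)), real_inner_comm (h (k + 2) - z)] at h1
    have key := admm_energy_le (ρ := ρ) (a := l (k + 2) - μ) (b := h (k + 2) - z)
      (r := h (k + 2) - g (k + 2)) (d := h (k + 2) - h (k + 1)) hρ.le (by
        rw [inner_sub_left]
        nlinarith)
    have e1 : l (k + 2) - μ - ρ • (h (k + 2) - g (k + 2)) = l (k + 1) - μ := by rw [hlk]; abel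
    have e2 : h (k + 2) - z - (h (k + 2) - h (k + 1)) = h (k + 1) - z := by abel
    rwa [e1, e2] at key
  have hVanti : Antitone V := antitone_nat_of_succ_le fun k => by
    have := hdesc k
    have : 0 ≤ ρ ^ 2 * ‖h (k + 2) - g (k + 2)‖ ^ 2 + ρ ^ 2 * ‖h (k + 2) - h (k + 1)‖ ^ 2 := by
      positivity
    linarith
  have hV0 : ∀ k, 0 ≤ V k := fun k => by rw [hV]; positivity
  have hVlim := tendsto_atTop_ciInf hVanti ⟨0, by rintro _ ⟨k, rfl⟩; exact hV0 k⟩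
  have hVdiff : Tendsto (fun k => (V k - V (k + 1)) / ρ ^ 2) atTop (nhds 0) := by
    simpa using (hVlim.sub (hVlim.comp (tendsto_add_atTop_nat 1))).div_const (ρ ^ 2)
  have hlim_of_le : ∀ u : ℕ → E, (∀ k, ρ ^ 2 * ‖u k‖ ^ 2 ≤ V k - V (k + 1)) →
      Tendsto u atTop (nhds 0) := by
    intro u hu
    rw [tendsto_zero_iff_norm_tendsto_zero]
    have : Tendsto (fun k => ‖u k‖ ^ 2) atTop (nhds 0) :=
      squeeze_zero (fun k => by positivity) (fun k => by
        rw [le_div_iff₀ (by positivity)]; linarith [hu k]) hVdiff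
    simpa using this.sqrt
  have hr : Tendsto (fun k => h (k + 2) - g (k + 2)) atTop (nhds 0) := hlim_of_le _ fun k => by
    have := hdesc k
    have : 0 ≤ ρ ^ 2 * ‖h (k + 2) - h (k + 1)‖ ^ 2 := by positivity
    linarith
  have hs : Tendsto (fun k => h (k + 2) - h (k + 1)) atTop (nhds 0) := hlim_of_le _ fun k => by
    have := hdesc k
    have : 0 ≤ ρ ^ 2 * ‖h (k + 2) - g (k + 2)‖ ^ 2 := by positivity
    linarith
  refine ⟨?_, (tendsto_add_atTop_iff_nat 2).1 hr⟩
  have hVle : ∀ k, V (k + 1) ≤ V 0 := fun k => hVanti (Nat.zero_le _)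
  have hlbd : ∀ k, ‖l (k + 2)‖ ≤ √(V 0) + ‖μ‖ := fun k => by
    have h1 : ‖l (k + 2) - μ‖ ≤ √(V 0) := Real.le_sqrt_of_sq_le <| by
      have h0 := hVle k
      rw [hV (k + 1)] at h0
      have : 0 ≤ ρ ^ 2 * ‖h (k + 1 + 1) - z‖ ^ 2 := by positivity
      linarith
    linarith [norm_sub_norm_le (l (k + 2)) μ]
  have hhbd : ∀ k, ‖z - h (k + 2)‖ ≤ √(V 0) / ρ := fun k => by
    rw [le_div_iff₀ hρ]
    refine Real.le_sqrt_of_sq_le ?_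
    have h0 := hVle k
    rw [hV (k + 1)] at h0
    rw [norm_sub_rev, mul_pow]
    linarith [sq_nonneg ‖l (k + 1 + 1) - μ‖]
  have hbd : ∀ (C : ℝ) (u v : ℕ → E), (∀ k, ‖u k‖ ≤ C) → Tendsto v atTop (nhds 0) →
      Tendsto (fun k => inner ℝ (u k) (v k)) atTop (nhds 0) := by
    intro C u v hu hv
    refine squeeze_zero_norm (fun k => (norm_inner_le_norm (𝕜 := ℝ) (u k) (v k)).trans
      (mul_le_mul_of_nonneg_right (hu k) (norm_nonneg _))) ?_
    simpa using hv.norm.const_mul C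
  have e1 := hbd _ _ _ hlbd hr
  have e2 := (hbd _ _ _ hhbd hs).add (hr.inner hs (𝕜 := ℝ))
  have e3 := hbd ‖μ‖ (fun _ => μ) _ (fun _ => le_rfl) hr
  refine (tendsto_add_atTop_iff_nat 2).1 (tendsto_of_tendsto_of_tendsto_of_le_of_le
    (g := fun k => inner ℝ c z - inner ℝ μ (h (k + 2) - g (k + 2)))
    (h := fun k => inner ℝ c z - inner ℝ (l (k + 2)) (h (k + 2) - g (k + 2)) +
      ρ * (inner ℝ (z - h (k + 2)) (h (k + 2) - h (k + 1)) +
        inner ℝ (h (k + 2) - g (k + 2)) (h (k + 2) - h (k + 1)))) ?_ ?_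
    (fun k => hlower (k + 1)) (fun k => ?_))
  · simpa using e3.const_sub (inner ℝ c z)
  · simpa using (e1.const_sub (inner ℝ c z)).add (e2.const_mul ρ)
  · have := hupper (k + 1)
    simp only [add_assoc, Nat.reduceAdd] at this
    beta_reduce
    rwa [← inner_add_left, sub_add_sub_cancel, real_inner_comm (h (k + 2) - h (k + 1))]

/-- Matrices as vectors of a Euclidean space; this carries the Frobenius norm to the Euclidean
norm. -/
noncomputable def frobEquiv (n : Type*) : Matrix n n ℝ ≃ₗ[ℝ] EuclideanSpace ℝ (n × n) :=
  (LinearEquiv.curry ℝ ℝ n n).symm ≪≫ₗ (WithLp.linearEquiv 2 ℝ (n × n → ℝ)).symm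

@[simp]
theorem frobEquiv_apply {n : Type*} (A : Matrix n n ℝ) (i : n × n) :
    frobEquiv n A i = A i.1 i.2 := rfl

theorem norm_frobEquiv {n : Type*} [Fintype n] (A : Matrix n n ℝ) :
    ‖frobEquiv n A‖ = frobNorm A := by
  simp [EuclideanSpace.norm_eq, frobNorm, Fintype.sum_prod_type]

theorem inner_frobEquiv {n : Type*} [Fintype n] {C : Matrix n n ℝ} (hC : C.IsSymm)
    (A : Matrix n n ℝ) : inner ℝ (frobEquiv n C) (frobEquiv n A) = (C * A).trace := by
  simp only [PiLp.inner_apply, frobEquiv_apply, Fintype.sum_prod_type, trace, diag, mul_apply,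
    RCLike.inner_apply, conj_trivial]
  rw [Finset.sum_comm]
  refine Finset.sum_congr rfl fun p _ => Finset.sum_congr rfl fun q _ => ?_
  rw [hC.apply, mul_comm]

/-- The identity matrix is interior to the matrices with nonnegative quadratic form. -/
theorem frobEquiv_one_mem_interior {n : Type*} [Fintype n] [DecidableEq n] :
    frobEquiv n 1 ∈ interior {x : EuclideanSpace ℝ (n × n) |
      ∀ v : n → ℝ, 0 ≤ v ⬝ᵥ ((frobEquiv n).symm x *ᵥ v)} := by
  rw [mem_interior_iff_mem_nhds, Metric.mem_nhds_iff]
  refine ⟨((Fintype.card n : ℝ) + 1)⁻¹, by positivity, fun x hx v => ?_⟩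
  obtain ⟨B, rfl⟩ := (frobEquiv n).surjective x
  rw [LinearEquiv.symm_apply_apply]
  set δ := ((Fintype.card n : ℝ) + 1)⁻¹ with hδ
  have hB : ∀ p q, |(B - 1) p q| ≤ δ := fun p q => by
    rw [Metric.mem_ball, dist_eq_norm, ← map_sub] at hx
    exact (PiLp.norm_apply_le (frobEquiv n (B - 1)) (p, q)).trans hx.le
  have hsplit : v ⬝ᵥ (B *ᵥ v) = ∑ p, v p ^ 2 + ∑ p, ∑ q, (B - 1) p q * (v p * v q) := by
    have : B = 1 + (B - 1) := by abel
    conv_lhs => rw [this, add_mulVec, dotProduct_add, one_mulVec]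
    congr 1
    · simp [dotProduct, sq]
    · simp only [dotProduct, mulVec, Finset.mul_sum]
      exact Finset.sum_congr rfl fun p _ => Finset.sum_congr rfl fun q _ => by ring
  have hle : ∑ p, ∑ q, -(δ * ((v p ^ 2 + v q ^ 2) / 2)) ≤
      ∑ p, ∑ q, (B - 1) p q * (v p * v q) := by
    refine Finset.sum_le_sum fun p _ => Finset.sum_le_sum fun q _ => ?_
    have h1 : |(B - 1) p q * (v p * v q)| ≤ δ * ((v p ^ 2 + v q ^ 2) / 2) := by
      rw [abs_mul]
      refine mul_le_mul (hB p q) ?_ (abs_nonneg _) (by positivity)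
      rw [abs_le]
      constructor <;> nlinarith [sq_nonneg (v p + v q), sq_nonneg (v p - v q)]
    exact neg_le_of_abs_le h1
  have hsum : ∑ p, ∑ q, -(δ * ((v p ^ 2 + v q ^ 2) / 2)) =
      -(δ * Fintype.card n * ∑ p, v p ^ 2) := by
    simp only [Finset.sum_neg_distrib, ← Finset.mul_sum, ← Finset.sum_div, Finset.sum_add_distrib,
      Finset.sum_const, Finset.card_univ, nsmul_eq_mul]
    ring
  have hδ1 : δ * Fintype.card n ≤ 1 := by
    rw [hδ, inv_mul_le_iff₀ (by positivity)]
    linarith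
  have hnn : 0 ≤ ∑ p, v p ^ 2 := Finset.sum_nonneg fun p _ => sq_nonneg _
  rw [hsplit]
  nlinarith

/-- **Convergence of the ADMM solver.** Let `L = (M+1)d` (indices are
modelled as pairs `(i, p) : Fin (M+1) × Fin d`, so the `i`-th diagonal `d × d` block of
`G` is `fun p q => G (i,p) (i,q)`). Let `C` be a symmetric `L × L` matrix, `𝕊₊` the
symmetric positive semidefinite matrices, `Ω` the symmetric matrices whose diagonal
`d × d` blocks all equal `I_d`, and let `F*` be the minimum of `Tr(C G)` over the
feasible set `{G ∈ 𝕊₊ : [G]_ii = I_d}`. Fix `ρ > 0` and let `Π_{𝕊₊}`, `Π_Ω` be the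
nearest-point (Frobenius) projections onto `𝕊₊` and `Ω`. Starting from symmetric `H⁰`
and `Λ⁰`, the ADMM iterates
`G^{k+1} = Π_{𝕊₊}(H^k − ρ⁻¹(C − Λ^k))`, `H^{k+1} = Π_Ω(G^{k+1} − ρ⁻¹Λ^k)`,
`Λ^{k+1} = Λ^k + ρ(H^{k+1} − G^{k+1})` satisfy objective convergence
`Tr(C G^k) → F*` and asymptotic feasibility `[G^k]_ii → I_d` for each `i`. -/
theorem admm_convergence
    (d M : ℕ) (hd : 1 ≤ d) (hM : 1 ≤ M)
    (C : Matrix (Fin (M + 1) × Fin d) (Fin (M + 1) × Fin d) ℝ) (hC : C.IsSymm)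
    (Fstar : ℝ)
    (hFstar : IsLeast {v : ℝ |
      ∃ G : Matrix (Fin (M + 1) × Fin d) (Fin (M + 1) × Fin d) ℝ, G.PosSemidef ∧
        (∀ (i : Fin (M + 1)) (p q : Fin d),
          G (i, p) (i, q) = (1 : Matrix (Fin d) (Fin d) ℝ) p q) ∧
        v = (C * G).trace} Fstar)
    (ρ : ℝ) (hρ : 0 < ρ)
    (projS projΩ : Matrix (Fin (M + 1) × Fin d) (Fin (M + 1) × Fin d) ℝ →
      Matrix (Fin (M + 1) × Fin d) (Fin (M + 1) × Fin d) ℝ)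
    -- `projS` is the nearest-point projection onto `𝕊₊` in the Frobenius norm
    (hprojS : ∀ A, (projS A).PosSemidef ∧
      ∀ X : Matrix (Fin (M + 1) × Fin d) (Fin (M + 1) × Fin d) ℝ, X.PosSemidef →
        frobNorm (projS A - A) ≤ frobNorm (X - A))
    -- `projΩ` is the nearest-point projection onto `Ω` in the Frobenius norm
    (hprojΩ : ∀ A, ((projΩ A).IsSymm ∧
      ∀ (i : Fin (M + 1)) (p q : Fin d),
        (projΩ A) (i, p) (i, q) = (1 : Matrix (Fin d) (Fin d) ℝ) p q) ∧
      ∀ X : Matrix (Fin (M + 1) × Fin d) (Fin (M + 1) × Fin d) ℝ,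
        (X.IsSymm ∧ ∀ (i : Fin (M + 1)) (p q : Fin d),
          X (i, p) (i, q) = (1 : Matrix (Fin d) (Fin d) ℝ) p q) →
        frobNorm (projΩ A - A) ≤ frobNorm (X - A))
    (G H Λ : ℕ → Matrix (Fin (M + 1) × Fin d) (Fin (M + 1) × Fin d) ℝ)
    (hH0 : (H 0).IsSymm) (hΛ0 : (Λ 0).IsSymm)
    (hG : ∀ k : ℕ, G (k + 1) = projS (H k - ρ⁻¹ • (C - Λ k)))
    (hH : ∀ k : ℕ, H (k + 1) = projΩ (G (k + 1) - ρ⁻¹ • Λ k))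
    (hΛ : ∀ k : ℕ, Λ (k + 1) = Λ k + ρ • (H (k + 1) - G (k + 1))) :
    Tendsto (fun k : ℕ => (C * G k).trace) atTop (nhds Fstar) ∧
    ∀ (i : Fin (M + 1)) (p q : Fin d),
      Tendsto (fun k : ℕ => G k (i, p) (i, q)) atTop
        (nhds ((1 : Matrix (Fin d) (Fin d) ℝ) p q)) := by
  let e := frobEquiv (Fin (M + 1) × Fin d)
  have hinner : ∀ A, inner ℝ (e C) (e A) = (C * A).trace := inner_frobEquiv hC
  have hnorm : ∀ A, ‖e A‖ = frobNorm A := norm_frobEquiv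
  obtain ⟨⟨Z, hZ, hZblock, rfl⟩, hmin⟩ := hFstar
  let P : Set (EuclideanSpace ℝ ((Fin (M + 1) × Fin d) × Fin (M + 1) × Fin d)) :=
    {x | (e.symm x).PosSemidef}
  let Ω : Set (EuclideanSpace ℝ ((Fin (M + 1) × Fin d) × Fin (M + 1) × Fin d)) :=
    {x | (e.symm x).IsSymm ∧
    ∀ (i : Fin (M + 1)) (p q : Fin d),
      e.symm x (i, p) (i, q) = (1 : Matrix (Fin d) (Fin d) ℝ) p q}
  have hP : Convex ℝ P := by
    intro x hx y hy a b ha hb _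
    simp only [P, Set.mem_ofPred_eq, map_add, map_smul] at hx hy ⊢
    exact (hx.smul ha).add (hy.smul hb)
  have hΩ : Convex ℝ Ω := by
    rintro x ⟨hx, hx'⟩ y ⟨hy, hy'⟩ a b _ _ hab
    simp only [Ω, Set.mem_ofPred_eq, map_add, map_smul]
    refine ⟨(hx.smul a).add (hy.smul b), fun i p q => ?_⟩
    rw [Matrix.add_apply, Matrix.smul_apply, Matrix.smul_apply, hx', hy', ← add_smul, hab, one_smul]
  -- The feasible set, enlarged to matrices that need not be symmetric.
  let K' : Set (EuclideanSpace ℝ ((Fin (M + 1) × Fin d) × Fin (M + 1) × Fin d)) :=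
    {x |
    ∀ v : Fin (M + 1) × Fin d → ℝ, 0 ≤ v ⬝ᵥ (e.symm x *ᵥ v)}
  let Ω' : Set (EuclideanSpace ℝ ((Fin (M + 1) × Fin d) × Fin (M + 1) × Fin d)) :=
    {x | ∀ (i : Fin (M + 1)) (p q : Fin d),
    e.symm x (i, p) (i, q) + e.symm x (i, q) (i, p) = 2 * (1 : Matrix (Fin d) (Fin d) ℝ) p q}
  have hK' : Convex ℝ K' := by
    intro x hx y hy a b ha hb _ v
    simp only [map_add, map_smul, add_mulVec, smul_mulVec, dotProduct_add, dotProduct_smul,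
      smul_eq_mul]
    exact add_nonneg (mul_nonneg ha (hx v)) (mul_nonneg hb (hy v))
  have hΩ' : Convex ℝ Ω' := by
    intro x hx y hy a b _ _ hab i p q
    simp only [map_add, map_smul, Matrix.add_apply, Matrix.smul_apply, smul_eq_mul]
    linear_combination a * hx i p q + b * hy i p q +
      2 * (1 : Matrix (Fin d) (Fin d) ℝ) p q * hab
  have hone : e 1 ∈ Ω' := fun i p q => by
    simp only [LinearEquiv.symm_apply_apply, one_apply, Prod.mk.injEq, true_and, eq_comm (a := q)]
    ring
  have hbound : ∀ x ∈ K', x ∈ Ω' → (C * Z).trace ≤ inner ℝ (e C) x := by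
    intro x hxK hxΩ
    obtain ⟨A, rfl⟩ := e.surjective x
    rw [hinner]
    refine hmin ⟨(2⁻¹ : ℝ) • (A + Aᵀ), ?_, fun i p q => ?_, ?_⟩
    · refine .of_dotProduct_mulVec_nonneg ?_ fun v => ?_
      · ext p q
        simp [add_comm, mul_add]
      · have h := hxK v
        rw [LinearEquiv.symm_apply_apply] at h
        rw [star_trivial, smul_mulVec, add_mulVec, dotProduct_smul, dotProduct_add,
          mulVec_transpose, dotProduct_comm v (v ᵥ* A), ← dotProduct_mulVec, smul_eq_mul]
        linarith
    · have h := hxΩ i p q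
      rw [LinearEquiv.symm_apply_apply] at h
      rw [Matrix.smul_apply, Matrix.add_apply, transpose_apply, h, smul_eq_mul]
      ring
    · have h : (C * Aᵀ).trace = (C * A).trace := by
        rw [← trace_transpose, transpose_mul, transpose_transpose, hC.eq, trace_mul_comm]
      rw [Matrix.mul_smul, Matrix.mul_add, trace_smul, trace_add, h, smul_eq_mul]
      ring
  obtain ⟨f, hf⟩ := exists_multiplier_of_mem_interior hK' hΩ' frobEquiv_one_mem_interior hone
    (innerSL ℝ (e C)) hbound
  have hsaddle : ∀ g ∈ P, ∀ h ∈ Ω, inner ℝ (e C) (e Z) ≤ inner ℝ (e C) g +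
      inner ℝ ((InnerProductSpace.toDual ℝ _).symm f) (h - g) := by
    intro g hg h hh
    rw [InnerProductSpace.toDual_symm_apply, hinner]
    exact hf g hg.dotProduct_mulVec_nonneg h fun i p q => by
      rw [hh.2, hh.2, isSymm_one.apply p q]
      ring
  have hGP : ∀ k, (G (k + 1)).PosSemidef := fun k => by
    rw [hG]
    exact (hprojS _).1
  have hHΩ : ∀ k, (H (k + 1)).IsSymm ∧ ∀ (i : Fin (M + 1)) (p q : Fin d),
      H (k + 1) (i, p) (i, q) = (1 : Matrix (Fin d) (Fin d) ℝ) p q := fun k => by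
    rw [hH]
    exact (hprojΩ _).1
  obtain ⟨hobj, hres⟩ := tendsto_inner_and_residual_of_admm hP hΩ (c := e C) (z := e Z)
    (g := fun k => e (G k)) (h := fun k => e (H k)) (l := fun k => e (Λ k))
    (by simpa [P] using hZ)
    (by simpa only [Ω, Set.mem_ofPred_eq, LinearEquiv.symm_apply_apply] using
      ⟨hZ.isHermitian, hZblock⟩)
    hsaddle hρ
    (fun k => by simpa [P] using hGP k)
    (fun k x hx => by
      obtain ⟨X, rfl⟩ := e.surjective x
      simp only [← map_sub, ← map_smul]
      rw [hnorm, hnorm, hG]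
      exact (hprojS _).2 X (by simpa [P] using hx))
    (fun k => by
      simpa only [Ω, Set.mem_ofPred_eq, LinearEquiv.symm_apply_apply] using hHΩ k)
    (fun k x hx => by
      obtain ⟨X, rfl⟩ := e.surjective x
      simp only [← map_sub, ← map_smul]
      rw [hnorm, hnorm, hH]
      exact (hprojΩ _).2 X (by
        simpa only [Ω, Set.mem_ofPred_eq, LinearEquiv.symm_apply_apply] using hx))
    (fun k => by simp only [← map_sub, ← map_smul, ← map_add, hΛ])
  refine ⟨by simpa only [hinner] using hobj, fun i p q => ?_⟩
  refine (tendsto_add_atTop_iff_nat 1).1 ?_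
  have h1 := ((EuclideanSpace.proj (𝕜 := ℝ) ((i, p), (i, q))).continuous.tendsto _).comp
    (hres.comp (tendsto_add_atTop_nat 1))
  have h2 := h1.const_sub ((1 : Matrix (Fin d) (Fin d) ℝ) p q)
  rw [map_zero, sub_zero] at h2
  refine h2.congr fun k => ?_
  simp [e, (hHΩ k).2]
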